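/- arXiv:2211.00162 — 4 statements merged into one kernel-verified Lean document; each statement's English description precedes it below -/
import Mathlib

section
/- Let X be a nonempty set, T ≥ 1 and N ≥ 1 integers, f : X → ℝ, and for each t ∈ {1,…,T} let l_{0,t}, u_{0,t} : X → ℝ and l_{1,t}, …, l_{N,t} : X → ℝ. Suppose: (i) x* ∈ X satisfies, for every t, l_{i,t}(x*) ≤ 0 for all i ∈ {1,…,N} and l_{0,t}(x*) ≤ f(x*); (ii) for each t, the point x_t ∈ X satisfies l_{i,t}(x_t) ≤ 0 for all i ∈ {1,…,N} and l_{0,t}(x_t) ≤ l_{0,t}(x) for every x ∈ X with l_{i,t}(x) ≤ 0 for all i; (iii) for each t, l_{0,t}(x_t) ≤ f(x_t) ≤ u_{0,t}(x_t); (iv) there are real numbers b_1 ≤ … ≤ b_T with b_t ≥ 0, real numbers s_t ≥ 0 with u_{0,t}(x_t) − l_{0,t}(x_t) ≤ 2 b_t s_t for each t, a real γ ≥ 0, and ∑_{t=1}^T s_t ≤ 2√((T+2)γ). Then ∑_{t=1}^T (f(x_t) − f(x*)) ≤ ∑_{t=1}^T max(f(x_t) − f(x*), 0) ≤ 4 b_T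 √((T+2)γ). -/
theorem stmt_5 {X : Type*} [Nonempty X] (T N : ℕ) (hT : 1 ≤ T) (hN : 1 ≤ N)
    (f : X → ℝ) (l0 u0 : ℕ → X → ℝ) (l : ℕ → ℕ → X → ℝ)
    (xstar : X) (x : ℕ → X)
    (hstar_feas : ∀ t ∈ Finset.Icc 1 T, ∀ i ∈ Finset.Icc 1 N, l i t xstar ≤ 0)
    (hstar_lb : ∀ t ∈ Finset.Icc 1 T, l0 t xstar ≤ f xstar)
    (hxt_feas : ∀ t ∈ Finset.Icc 1 T, ∀ i ∈ Finset.Icc 1 N, l i t (x t) ≤ 0)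
    (hxt_min : ∀ t ∈ Finset.Icc 1 T, ∀ y : X,
      (∀ i ∈ Finset.Icc 1 N, l i t y ≤ 0) → l0 t (x t) ≤ l0 t y)
    (h_lb : ∀ t ∈ Finset.Icc 1 T, l0 t (x t) ≤ f (x t))
    (h_ub : ∀ t ∈ Finset.Icc 1 T, f (x t) ≤ u0 t (x t))
    (b s : ℕ → ℝ) (γ : ℝ) (hγ : 0 ≤ γ)
    (hb_nonneg : ∀ t ∈ Finset.Icc 1 T, 0 ≤ b t)
    (hb_mono : ∀ t ∈ Finset.Icc 1 T, ∀ t' ∈ Finset.Icc 1 T, t ≤ t' → b t ≤ b t')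
    (hs : ∀ t ∈ Finset.Icc 1 T, 0 ≤ s t)
    (hw : ∀ t ∈ Finset.Icc 1 T, u0 t (x t) - l0 t (x t) ≤ 2 * b t * s t)
    (hsum : ∑ t ∈ Finset.Icc 1 T, s t ≤ 2 * Real.sqrt ((T + 2) * γ)) :
    ∑ t ∈ Finset.Icc 1 T, (f (x t) - f xstar) ≤
        ∑ t ∈ Finset.Icc 1 T, max (f (x t) - f xstar) 0 ∧
      ∑ t ∈ Finset.Icc 1 T, max (f (x t) - f xstar) 0 ≤
        4 * b T * Real.sqrt ((T + 2) * γ) := by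
  have hTmem : T ∈ Finset.Icc 1 T := Finset.mem_Icc.mpr ⟨hT, le_rfl⟩
  refine ⟨Finset.sum_le_sum fun t _ => le_max_left _ _, ?_⟩
  have hbound : ∀ t ∈ Finset.Icc 1 T, max (f (x t) - f xstar) 0 ≤ 2 * b T * s t := by
    intro t ht
    have hbs : b t * s t ≤ b T * s t :=
      mul_le_mul_of_nonneg_right
        (hb_mono t ht T hTmem (Finset.mem_Icc.mp ht).2) (hs t ht)
    have hopt := hxt_min t ht xstar (hstar_feas t ht)
    refine max_le ?_ ?_
    · linarith [hstar_lb t ht, h_ub t ht, hw t ht]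
    · linarith [mul_nonneg (hb_nonneg T hTmem) (hs t ht)]
  calc ∑ t ∈ Finset.Icc 1 T, max (f (x t) - f xstar) 0
      ≤ ∑ t ∈ Finset.Icc 1 T, 2 * b T * s t := Finset.sum_le_sum hbound
    _ = 2 * b T * ∑ t ∈ Finset.Icc 1 T, s t := by rw [Finset.mul_sum]
    _ ≤ 2 * b T * (2 * Real.sqrt ((T + 2) * γ)) :=
      mul_le_mul_of_nonneg_left hsum (by linarith [hb_nonneg T hTmem])
    _ = 4 * b T * Real.sqrt ((T + 2) * γ) := by ring
end

section
/- Let X be a nonempty set, T ≥ 1 an integer, g : X → ℝ, and for each t ∈ {1,…,T} let l_t, u_t : X → ℝ. Suppose for each t ∈ {1,…,T} the point x_t ∈ X satisfies l_t(x_t) ≤ g(x_t) ≤ u_t(x_t) and l_t(x_t) ≤ 0. Suppose further there are real numbers b_1 ≤ … ≤ b_T with b_t ≥ 0, real numbers s_t ≥ 0 with u_t(x_t) − l_t(x_t) ≤ 2 b_t s_t for each t, a real γ ≥ 0, and ∑_{t=1}^T s_t ≤ 2√((T+2)γ). Then the cumulative violation satisfies ∑_{t=1}^T max(g(x_t), 0)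 ≤ 4 b_T √((T+2)γ). -/
theorem stmt_6 {X : Type*} [Nonempty X] (T : ℕ) (hT : 1 ≤ T)
    (g : X → ℝ) (l u : ℕ → X → ℝ) (x : ℕ → X)
    (h_sand : ∀ t ∈ Finset.Icc 1 T, l t (x t) ≤ g (x t) ∧ g (x t) ≤ u t (x t))
    (h_feas : ∀ t ∈ Finset.Icc 1 T, l t (x t) ≤ 0)
    (b s : ℕ → ℝ) (γ : ℝ) (hγ : 0 ≤ γ)
    (hb_nonneg : ∀ t ∈ Finset.Icc 1 T, 0 ≤ b t)
    (hb_mono : ∀ t ∈ Finset.Icc 1 T, ∀ t' ∈ Finset.Icc 1 T, t ≤ t' → b t ≤ b t')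
    (hs : ∀ t ∈ Finset.Icc 1 T, 0 ≤ s t)
    (hw : ∀ t ∈ Finset.Icc 1 T, u t (x t) - l t (x t) ≤ 2 * b t * s t)
    (hsum : ∑ t ∈ Finset.Icc 1 T, s t ≤ 2 * Real.sqrt ((T + 2) * γ)) :
    ∑ t ∈ Finset.Icc 1 T, max (g (x t)) 0 ≤ 4 * b T * Real.sqrt ((T + 2) * γ) := by
  have hTmem : T ∈ Finset.Icc 1 T := Finset.mem_Icc.mpr ⟨hT, le_rfl⟩
  have hbT : 0 ≤ b T := hb_nonneg T hTmem
  have hterm : ∀ t ∈ Finset.Icc 1 T, max (g (x t)) 0 ≤ 2 * b T * s t := by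
    intro t ht
    have hbt : b t * s t ≤ b T * s t :=
      mul_le_mul_of_nonneg_right (hb_mono t ht T hTmem (Finset.mem_Icc.mp ht).2) (hs t ht)
    have hbs : 0 ≤ b T * s t := mul_nonneg hbT (hs t ht)
    apply max_le
    · linarith [(h_sand t ht).2, h_feas t ht, hw t ht]
    · linarith
  calc ∑ t ∈ Finset.Icc 1 T, max (g (x t)) 0
      ≤ ∑ t ∈ Finset.Icc 1 T, 2 * b T * s t := Finset.sum_le_sum hterm
    _ = 2 * b T * ∑ t ∈ Finset.Icc 1 T, s t := (Finset.mul_sum _ _ _).symm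
    _ ≤ 2 * b T * (2 * Real.sqrt ((T + 2) * γ)) :=
        mul_le_mul_of_nonneg_left hsum (by positivity)
    _ = 4 * b T * Real.sqrt ((T + 2) * γ) := by ring
end

section
/- Let X be a nonempty set, T ≥ 1 and N ≥ 1 integers, f : X → ℝ, g_1, …, g_N : X → ℝ, and for each t ∈ {1,…,T} and i ∈ {0,1,…,N} let l_{i,t}, u_{i,t} : X → ℝ. Suppose: (i) x* ∈ X satisfies, for every t, l_{i,t}(x*) ≤ 0 for all i ∈ {1,…,N} and l_{0,t}(x*) ≤ f(x*); (ii) for each t, the point x_t ∈ X satisfies l_{i,t}(x_t) ≤ 0 for all i ∈ {1,…,N} and l_{0,t}(x_t) ≤ l_{0,t}(x) for every x ∈ X with l_{i,t}(x) ≤ 0 for all i; (iii) for each t, l_{0,t}(x_t) ≤ f(x_t) ≤ u_{0,t}(x_t) and l_{i,t}(x_t) ≤ g_i(x_t) ≤ u_{i,t}(x_t) for all i ∈ {1,…,N}; (iv) for each i ∈ {0,1,…,N} there are real numbers b_{i,1} ≤ … ≤ b_{i,T} with b_{i,t} ≥ 0, real numbers s_{i,t} ≥ 0 with u_{i,t}(x_t)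 − l_{i,t}(x_t) ≤ 2 b_{i,t} s_{i,t} for each t, a real γ_i ≥ 0, and ∑_{t=1}^T s_{i,t} ≤ 2√((T+2)γ_i). Then there exists t₀ ∈ {1,…,T} such that f(x_{t₀}) − f(x*) ≤ (4√(T+2) ∑_{i=0}^N b_{i,T} √(γ_i)) / T and max(g_i(x_{t₀}), 0) ≤ (4√(T+2) ∑_{i=0}^N b_{i,T} √(γ_i)) / T for every i ∈ {1,…,N}. -/
/-- If the widths `w t` are bounded by `2 * b t * s t` with `b` nondecreasing, their sum is controlled
by the final value of `b` and any bound on the sum of the `s t`. -/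
theorem sum_width_le {T : ℕ} {w b s : ℕ → ℝ} {S : ℝ}
    (hbT : 0 ≤ b T) (hb : ∀ t ∈ Finset.Icc 1 T, b t ≤ b T)
    (hs : ∀ t ∈ Finset.Icc 1 T, 0 ≤ s t)
    (hw : ∀ t ∈ Finset.Icc 1 T, w t ≤ 2 * b t * s t)
    (hS : ∑ t ∈ Finset.Icc 1 T, s t ≤ S) :
    ∑ t ∈ Finset.Icc 1 T, w t ≤ 2 * b T * S :=
  calc ∑ t ∈ Finset.Icc 1 T, w t ≤ ∑ t ∈ Finset.Icc 1 T, 2 * b T * s t :=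
        Finset.sum_le_sum fun t ht => (hw t ht).trans <|
          mul_le_mul_of_nonneg_right (by linarith [hb t ht]) (hs t ht)
    _ = 2 * b T * ∑ t ∈ Finset.Icc 1 T, s t := by rw [Finset.mul_sum]
    _ ≤ 2 * b T * S := by gcongr

/-- Some `w t` with `1 ≤ t ≤ T` is at most the average of any upper bound on their sum. -/
theorem exists_le_div_of_sum_Icc_le {T : ℕ} (hT : 1 ≤ T) {w : ℕ → ℝ} {C : ℝ}
    (h : ∑ t ∈ Finset.Icc 1 T, w t ≤ C) : ∃ t ∈ Finset.Icc 1 T, w t ≤ C / T := by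
  have hT' : (T : ℝ) ≠ 0 := by positivity
  refine Finset.exists_le_of_sum_le ⟨1, by simpa using hT⟩ (h.trans_eq ?_)
  simp only [Finset.sum_const, Nat.card_Icc, Nat.add_sub_cancel, nsmul_eq_mul]
  field_simp


theorem stmt_8 {X : Type*} [Nonempty X] (T N : ℕ) (hT : 1 ≤ T) (hN : 1 ≤ N)
    (f : X → ℝ) (g : ℕ → X → ℝ) (l u : ℕ → ℕ → X → ℝ)
    (xstar : X) (x : ℕ → X)
    (hstar_feas : ∀ t ∈ Finset.Icc 1 T, ∀ i ∈ Finset.Icc 1 N, l i t xstar ≤ 0)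
    (hstar_lb : ∀ t ∈ Finset.Icc 1 T, l 0 t xstar ≤ f xstar)
    (hxt_feas : ∀ t ∈ Finset.Icc 1 T, ∀ i ∈ Finset.Icc 1 N, l i t (x t) ≤ 0)
    (hxt_min : ∀ t ∈ Finset.Icc 1 T, ∀ y : X,
      (∀ i ∈ Finset.Icc 1 N, l i t y ≤ 0) → l 0 t (x t) ≤ l 0 t y)
    (hf_sand : ∀ t ∈ Finset.Icc 1 T, l 0 t (x t) ≤ f (x t) ∧ f (x t) ≤ u 0 t (x t))
    (hg_sand : ∀ t ∈ Finset.Icc 1 T, ∀ i ∈ Finset.Icc 1 N,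
      l i t (x t) ≤ g i (x t) ∧ g i (x t) ≤ u i t (x t))
    (b s : ℕ → ℕ → ℝ) (γ : ℕ → ℝ)
    (hγ : ∀ i ∈ Finset.range (N + 1), 0 ≤ γ i)
    (hb_nonneg : ∀ i ∈ Finset.range (N + 1), ∀ t ∈ Finset.Icc 1 T, 0 ≤ b i t)
    (hb_mono : ∀ i ∈ Finset.range (N + 1), ∀ t ∈ Finset.Icc 1 T, ∀ t' ∈ Finset.Icc 1 T,
      t ≤ t' → b i t ≤ b i t')
    (hs : ∀ i ∈ Finset.range (N + 1), ∀ t ∈ Finset.Icc 1 T, 0 ≤ s i t)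
    (hw : ∀ i ∈ Finset.range (N + 1), ∀ t ∈ Finset.Icc 1 T,
      u i t (x t) - l i t (x t) ≤ 2 * b i t * s i t)
    (hsum : ∀ i ∈ Finset.range (N + 1),
      ∑ t ∈ Finset.Icc 1 T, s i t ≤ 2 * Real.sqrt ((T + 2) * γ i)) :
    ∃ t0 ∈ Finset.Icc 1 T,
      f (x t0) - f xstar ≤
        (4 * Real.sqrt (T + 2) * ∑ i ∈ Finset.range (N + 1), b i T * Real.sqrt (γ i)) / T ∧
      ∀ i ∈ Finset.Icc 1 N, max (g i (x t0)) 0 ≤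
        (4 * Real.sqrt (T + 2) * ∑ i ∈ Finset.range (N + 1), b i T * Real.sqrt (γ i)) / T := by
  have hTmem : T ∈ Finset.Icc 1 T := by simpa using hT
  have hmem : ∀ i ∈ Finset.Icc 1 N, i ∈ Finset.range (N + 1) := fun i hi => by
    simp only [Finset.mem_Icc, Finset.mem_range] at hi ⊢
    omega
  have hzero : 0 ∈ Finset.range (N + 1) := by simp
  have htotal : ∑ t ∈ Finset.Icc 1 T, ∑ i ∈ Finset.range (N + 1), (u i t (x t) - l i t (x t)) ≤
      4 * Real.sqrt (T + 2) * ∑ i ∈ Finset.range (N + 1), b i T * Real.sqrt (γ i) := by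
    rw [Finset.sum_comm, Finset.mul_sum]
    refine Finset.sum_le_sum fun i hi => ?_
    refine (sum_width_le (hb_nonneg i hi T hTmem)
      (fun t ht => hb_mono i hi t ht T hTmem (Finset.mem_Icc.mp ht).2)
      (hs i hi) (hw i hi) (hsum i hi)).trans_eq ?_
    rw [Real.sqrt_mul (by positivity)]
    ring
  obtain ⟨t, ht, hwidth⟩ := exists_le_div_of_sum_Icc_le hT htotal
  have hgap_nonneg : ∀ i ∈ Finset.range (N + 1), 0 ≤ u i t (x t) - l i t (x t) := fun i hi => by
    rcases Nat.eq_zero_or_pos i with rfl | hpos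
    · linarith [hf_sand t ht]
    · have := hg_sand t ht i (Finset.mem_Icc.mpr ⟨hpos, Nat.lt_succ_iff.mp (Finset.mem_range.mp hi)⟩)
      linarith
  have hgap : ∀ i ∈ Finset.range (N + 1), u i t (x t) - l i t (x t) ≤
      (4 * Real.sqrt (T + 2) * ∑ i ∈ Finset.range (N + 1), b i T * Real.sqrt (γ i)) / T :=
    fun i hi => (Finset.single_le_sum hgap_nonneg hi).trans hwidth
  refine ⟨t, ht, ?_, fun i hi => max_le ?_ ?_⟩
  · linarith [hgap 0 hzero, hf_sand t ht, hxt_min t ht xstar (hstar_feas t ht), hstar_lb t ht]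
  · linarith [hgap i (hmem i hi), hg_sand t ht i hi, hxt_feas t ht i hi]
  · exact (hgap_nonneg 0 hzero).trans (hgap 0 hzero)
end

section
/- Let X be a nonempty set, T ≥ 1 an integer, ε > 0 a real number, g : X → ℝ with g(x) ≥ ε for all x ∈ X, and for each t ∈ {1,…,T} let l_t, u_t : X → ℝ. Suppose for each t the point x_t ∈ X satisfies l_t(x_t) ≤ 0 and g(x_t) ≤ u_t(x_t). Suppose further there are real numbers b_1 ≤ … ≤ b_T with b_t ≥ 0, real numbers s_t ≥ 0 with u_t(x_t) − l_t(x_t) ≤ 2 b_t s_t for each t, a real γ ≥ 0, and ∑_{t=1}^T s_t ≤ 2√((T+2)γ). Then T·ε ≤ 4 b_T √((T+2)γ). -/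
theorem stmt_9 {X : Type*} [Nonempty X] (T : ℕ) (hT : 1 ≤ T) (ε : ℝ) (hε : 0 < ε)
    (g : X → ℝ) (hg : ∀ x : X, ε ≤ g x)
    (l u : ℕ → X → ℝ) (x : ℕ → X)
    (hl : ∀ t ∈ Finset.Icc 1 T, l t (x t) ≤ 0)
    (hu : ∀ t ∈ Finset.Icc 1 T, g (x t) ≤ u t (x t))
    (b s : ℕ → ℝ) (γ : ℝ) (hγ : 0 ≤ γ)
    (hb_nonneg : ∀ t ∈ Finset.Icc 1 T, 0 ≤ b t)
    (hb_mono : ∀ t ∈ Finset.Icc 1 T, ∀ t' ∈ Finset.Icc 1 T, t ≤ t' → b t ≤ b t')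
    (hs : ∀ t ∈ Finset.Icc 1 T, 0 ≤ s t)
    (hw : ∀ t ∈ Finset.Icc 1 T, u t (x t) - l t (x t) ≤ 2 * b t * s t)
    (hsum : ∑ t ∈ Finset.Icc 1 T, s t ≤ 2 * Real.sqrt ((T + 2) * γ)) :
    (T : ℝ) * ε ≤ 4 * b T * Real.sqrt ((T + 2) * γ) := by
  have hT_mem : T ∈ Finset.Icc 1 T := Finset.mem_Icc.2 ⟨hT, le_rfl⟩
  have hε_le : ∀ t ∈ Finset.Icc 1 T, ε ≤ 2 * b T * s t := fun t ht => by
    have hbs : b t * s t ≤ b T * s t :=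
      mul_le_mul_of_nonneg_right (hb_mono t ht T hT_mem (Finset.mem_Icc.1 ht).2) (hs t ht)
    linarith [hg (x t), hl t ht, hu t ht, hw t ht]
  calc (T : ℝ) * ε = ∑ _t ∈ Finset.Icc 1 T, ε := by simp
    _ ≤ ∑ t ∈ Finset.Icc 1 T, 2 * b T * s t := Finset.sum_le_sum hε_le
    _ = 2 * b T * ∑ t ∈ Finset.Icc 1 T, s t := by rw [Finset.mul_sum]
    _ ≤ 2 * b T * (2 * Real.sqrt ((T + 2) * γ)) :=
      mul_le_mul_of_nonneg_left hsum (mul_nonneg zero_le_two (hb_nonneg T hT_mem))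
    _ = 4 * b T * Real.sqrt ((T + 2) * γ) := by ring
end
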